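/- arXiv:1604.02008 — 2 statements merged into one kernel-verified Lean document; each statement's English description precedes it below -/
import Mathlib

section
/- Verified Foster–Lyapunov drift condition for the exponential Lyapunov function (Condition (B) in the proof of Theorem 2): Let m, n ≥ 1, let a : {1,…,m} → ℝ with a_i > 0, let b > 0, A ∈ ℝ, R : {1,…,m} → ℝ, L ∈ (ℝ_{≥0})^n, and let λ : {1,…,m} × {1,…,m} → ℝ satisfy Σ_j λ_{ij} = 0 for every i. Suppose the BMI holds: for every i, (A − R_i)·b·a_i + Σ_j λ_{ij} a_j ≤ −1. Let φ, r : {1,…,m} × (ℝ_{≥0})^n → ℝ^n be functions such that for every mode i and every q ∈ (ℝ_{≥0})^n: (i) Σ_k φ_k(i,q) = A; (ii) 0 ≤ r_k(i,q) ≤ max_{j,k} u, i.e., the components of r(i,q) are bounded by a constant C ≥ 0; and (iii) whenever q_k > L_k for some k, Σ_k r_k(i,q) ≥ R_i − 1/(2 b max_j a_j). Define V(i,q) = a_i e^{b·|q|₁} with |q|₁ = Σ_k q_k, and F(i,q) = [ (Σ_k (φ_k(i,q) − r_k(i,q)))·a_i·b + Σ_j λ_{ij}(a_j − a_i) ]·e^{b|q|₁}.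 Then with c = 1/(2 max_j a_j) there exists d < ∞ such that F(i,q) ≤ −c·V(i,q) + d for all i ∈ {1,…,m} and all q ∈ (ℝ_{≥0})^n. -/
/-- Verified Foster–Lyapunov drift condition for the exponential Lyapunov
function (Condition (B) in the proof of Theorem 2). -/
theorem foster_lyapunov_drift_condition
    (m n : ℕ) (hm : 1 ≤ m) (hn : 1 ≤ n)
    (a : Fin m → ℝ) (ha : ∀ i, 0 < a i)
    (b : ℝ) (hb : 0 < b) (A : ℝ) (R : Fin m → ℝ)
    (L : Fin n → ℝ) (hL : ∀ k, 0 ≤ L k)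
    (lam : Fin m → Fin m → ℝ) (hlam : ∀ i, ∑ j, lam i j = 0)
    (amax : ℝ) (hamax : amax = Finset.univ.sup' ⟨⟨0, hm⟩, Finset.mem_univ _⟩ a)
    (hBMI : ∀ i, (A - R i) * b * a i + ∑ j, lam i j * a j ≤ -1)
    (φ r : Fin m → (Fin n → ℝ) → Fin n → ℝ)
    (hφ : ∀ i (q : Fin n → ℝ), (∀ k, 0 ≤ q k) → ∑ k, φ i q k = A)
    (C : ℝ) (hC : 0 ≤ C)
    (hr : ∀ i (q : Fin n → ℝ), (∀ k, 0 ≤ q k) →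
      ∀ k, 0 ≤ r i q k ∧ r i q k ≤ C)
    (hrR : ∀ i (q : Fin n → ℝ), (∀ k, 0 ≤ q k) → (∃ k, L k < q k) →
      R i - 1 / (2 * b * amax) ≤ ∑ k, r i q k) :
    ∃ d : ℝ, ∀ i (q : Fin n → ℝ), (∀ k, 0 ≤ q k) →
      ((∑ k, (φ i q k - r i q k)) * a i * b + ∑ j, lam i j * (a j - a i)) *
          Real.exp (b * ∑ k, q k)
        ≤ -(1 / (2 * amax)) * (a i * Real.exp (b * ∑ k, q k)) + d := by
  have hle : ∀ i, a i ≤ amax := fun i => hamax ▸ Finset.le_sup' a (Finset.mem_univ i)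
  have hM : 0 < amax := (ha ⟨0, hm⟩).trans_le (hle _)
  let K : Fin m → ℝ := fun i => |A| * a i * b + |∑ j, lam i j * a j| + a i / (2 * amax)
  have hK : ∀ i, 0 ≤ K i := fun i => by
    have := ha i
    positivity
  refine ⟨(∑ i, K i) * Real.exp (b * ∑ k, L k), fun i q hq => ?_⟩
  have hai := ha i
  have hφr : ∑ k, (φ i q k - r i q k) = A - ∑ k, r i q k := by
    rw [Finset.sum_sub_distrib, hφ i q hq]
  have hgen : ∑ j, lam i j * (a j - a i) = ∑ j, lam i j * a j := by
    simp only [mul_sub, Finset.sum_sub_distrib, ← Finset.sum_mul, hlam, zero_mul, sub_zero]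
  have hr_nonneg : 0 ≤ ∑ k, r i q k := Finset.sum_nonneg fun k _ => (hr i q hq k).1
  have hd : 0 ≤ (∑ i, K i) * Real.exp (b * ∑ k, L k) :=
    mul_nonneg (Finset.sum_nonneg fun i _ => hK i) (Real.exp_pos _).le
  rw [hφr, hgen]
  set S := ∑ j, lam i j * a j with hS
  set ρ := ∑ k, r i q k
  set E := Real.exp (b * ∑ k, q k) with hE
  have hE_pos : 0 < E := Real.exp_pos _
  suffices h : ((A - ρ) * a i * b + S + a i / (2 * amax)) * E ≤
      (∑ i, K i) * Real.exp (b * ∑ k, L k) by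
    have : -(1 / (2 * amax)) * (a i * E) = -(a i / (2 * amax) * E) := by ring
    rw [this]
    linarith
  by_cases hout : ∃ k, L k < q k
  · have hρ : A - ρ ≤ A - R i + 1 / (2 * b * amax) := by linarith [hrR i q hq hout]
    have hmul := mul_le_mul_of_nonneg_right hρ (mul_pos hai hb).le
    have heq : (A - R i + 1 / (2 * b * amax)) * (a i * b) =
        (A - R i) * b * a i + a i / (2 * amax) := by
      field_simp
    have hhalf : a i / (2 * amax) ≤ 1 / 2 := by
      rw [div_le_div_iff₀ (by positivity) two_pos]
      linarith [hle i]
    refine le_trans (mul_nonpos_of_nonpos_of_nonneg ?_ hE_pos.le) hd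
    linarith [hBMI i]
  · push Not at hout
    have hcoef : (A - ρ) * a i * b + S + a i / (2 * amax) ≤ K i := by
      have : (A - ρ) * a i * b ≤ |A| * a i * b := by
        gcongr
        linarith [le_abs_self A]
      have := le_abs_self S
      simp only [K, ← hS]
      linarith
    have hKi : K i ≤ ∑ i, K i :=
      Finset.single_le_sum (fun i _ => hK i) (Finset.mem_univ i)
    have hEL : E ≤ Real.exp (b * ∑ k, L k) :=
      Real.exp_le_exp.2 (mul_le_mul_of_nonneg_left
        (Finset.sum_le_sum fun k _ => hout k) hb.le)
    exact mul_le_mul (hcoef.trans hKi) hEL hE_pos.le ((hK i).trans hKi)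
end

section
/- The total queue in the nominal mode reaches zero in finite time (deterministic core of Condition (A) in Theorem 2): Let n ≥ 1, A ∈ ℝ, and let u : {1,…,n} → ℝ and φ : (ℝ_{≥0})^n → ℝ^n satisfy: Σ_k φ_k(q) = A for all q; 0 ≤ φ_k(0) < u_k for all k; and φ_k(q) ≥ φ_k(0) whenever q_k = 0. For q ∈ (ℝ_{≥0})^n define r_k(q) = u_k if q_k > 0 and r_k(q) = min{u_k, φ_k(q)} if q_k = 0. Let Q : [0,∞) → (ℝ_{≥0})^n be continuous and satisfy Q_k(t) = Q_k(0) + ∫₀ᵗ (φ_k(Q(s)) − r_k(Q(s))) ds for every k and t, with s ↦ φ_k(Q(s)) and s ↦ r_k(Q(s)) locally integrable. Set ε = min_k (u_k − φ_k(0)) > 0. Then there exists t* ∈ [0, |Q(0)|₁/ε], where |Q(0)|₁ = Σ_k Q_k(0), such that Q(t*) = 0. -/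
open MeasureTheory

/-- Away from the empty state the total drift `∑ k, (φ q k - r k)` is at most `-ε`, provided the
total inflow is the same as in the empty state, busy servers discharge at least `ε` above their
inflow in the empty state, and idle servers at least that inflow. -/
lemma sum_drift_le_neg {ι : Type*} [Fintype ι] {inflow inflow₀ r q : ι → ℝ} {ε : ℝ}
    (hε : 0 ≤ ε) (hsum : ∑ k, inflow k = ∑ k, inflow₀ k)
    (hbusy : ∀ k, q k ≠ 0 → inflow₀ k + ε ≤ r k)
    (hidle : ∀ k, q k = 0 → inflow₀ k ≤ r k) (hq : q ≠ 0) :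
    ∑ k, (inflow k - r k) ≤ -ε := by
  obtain ⟨j, hj⟩ := Function.ne_iff.mp hq
  have hnonneg : ∀ k ∈ Finset.univ, 0 ≤ r k - inflow₀ k := by
    intro k _
    by_cases hk : q k = 0
    · linarith [hidle k hk]
    · linarith [hbusy k hk]
  have hle := Finset.single_le_sum hnonneg (Finset.mem_univ j)
  rw [Finset.sum_sub_distrib] at hle ⊢
  linarith [hbusy j hj]

/-- The total queue in the nominal mode reaches zero in finite time
(deterministic core of Condition (A) in Theorem 2). -/
theorem queue_hits_zero_in_finite_time
    (n : ℕ) (hn : 1 ≤ n) (A : ℝ) (u : Fin n → ℝ)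
    (φ : (Fin n → ℝ) → Fin n → ℝ)
    (hφsum : ∀ q : Fin n → ℝ, (∀ k, 0 ≤ q k) → ∑ k, φ q k = A)
    (hφ0 : ∀ k, 0 ≤ φ 0 k ∧ φ 0 k < u k)
    (hmono : ∀ q : Fin n → ℝ, (∀ k, 0 ≤ q k) → ∀ k, q k = 0 → φ 0 k ≤ φ q k)
    (r : (Fin n → ℝ) → Fin n → ℝ)
    (hrdef : ∀ (q : Fin n → ℝ) (k : Fin n),
      r q k = if 0 < q k then u k else min (u k) (φ q k))
    (Q : ℝ → Fin n → ℝ) (hQc : Continuous Q)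
    (hQnn : ∀ t : ℝ, 0 ≤ t → ∀ k, 0 ≤ Q t k)
    (hint : ∀ (k : Fin n) (t : ℝ),
      IntervalIntegrable (fun s => φ (Q s) k - r (Q s) k) volume 0 t)
    (hQeq : ∀ (k : Fin n) (t : ℝ), 0 ≤ t →
      Q t k = Q 0 k + ∫ s in (0:ℝ)..t, (φ (Q s) k - r (Q s) k))
    (ε : ℝ)
    (hε : ε = Finset.univ.inf' ⟨⟨0, hn⟩, Finset.mem_univ _⟩
      (fun k => u k - φ 0 k)) :
    ∃ t₀ ∈ Set.Icc (0 : ℝ) ((∑ k, Q 0 k) / ε), Q t₀ = 0 := by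
  have hε_le : ∀ k, ε ≤ u k - φ 0 k := fun k => hε ▸ Finset.inf'_le _ (Finset.mem_univ k)
  have hε_pos : 0 < ε := by
    rw [hε]
    exact (Finset.lt_inf'_iff _).mpr fun k _ => sub_pos.mpr (hφ0 k).2
  have hdrift : ∀ q : Fin n → ℝ, (∀ k, 0 ≤ q k) → q ≠ 0 → ∑ k, (φ q k - r q k) ≤ -ε := by
    intro q hq hq0
    refine sum_drift_le_neg (inflow₀ := φ 0) hε_pos.le ?_ ?_ ?_ hq0
    · rw [hφsum q hq, hφsum 0 fun _ => le_rfl]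
    · intro k hk
      rw [hrdef, if_pos (lt_of_le_of_ne (hq k) (Ne.symm hk))]
      linarith [hε_le k]
    · intro k hk
      rw [hrdef, if_neg (by simp [hk])]
      exact le_min (hφ0 k).2.le (hmono q hq k hk)
  set T := (∑ k, Q 0 k) / ε with hT
  have hT0 : 0 ≤ T := div_nonneg (Finset.sum_nonneg fun k _ => hQnn 0 le_rfl k) hε_pos.le
  by_contra! hne
  have hbound : ∫ s in (0 : ℝ)..T, ∑ k, (φ (Q s) k - r (Q s) k) ≤ ∫ _ in (0 : ℝ)..T, -ε := by
    refine intervalIntegral.integral_mono_on hT0 ?_ intervalIntegrable_const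
      fun s hs => hdrift _ (hQnn s hs.1) (hne s hs)
    simpa only [Finset.sum_fn] using IntervalIntegrable.sum Finset.univ fun k _ => hint k T
  have htotal : ∑ k, Q T k ≤ 0 := by
    calc ∑ k, Q T k
        = ∑ k, Q 0 k + ∫ s in (0 : ℝ)..T, ∑ k, (φ (Q s) k - r (Q s) k) := by
          rw [intervalIntegral.integral_finsetSum fun k _ => hint k T, ← Finset.sum_add_distrib]
          exact Finset.sum_congr rfl fun k _ => hQeq k T hT0
      _ ≤ ∑ k, Q 0 k + ∫ _ in (0 : ℝ)..T, -ε := by gcongr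
      _ = 0 := by
          rw [intervalIntegral.integral_const, hT, smul_eq_mul]
          field_simp
          ring
  have hzero := (Finset.sum_eq_zero_iff_of_nonneg fun k _ => hQnn T hT0 k).mp
    (le_antisymm htotal (Finset.sum_nonneg fun k _ => hQnn T hT0 k))
  exact hne T ⟨hT0, le_rfl⟩ (funext fun k => hzero k (Finset.mem_univ k))
end
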